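/- arXiv:2308.06016 — 2 statements merged into one kernel-verified Lean document; each statement's English description precedes it below -/
import Mathlib

section
/- Let G_ω be an edge-weighted graph and H_ω an induced subgraph of G_ω. If the edge ideal I(G_ω) is normal, then the edge ideal I(H_ω) is also normal. -/
open MvPolynomial

/-- The edge ideal of an edge-weighted graph `G` with weight function `w`. -/
noncomputable def edgeIdeal (K : Type*) [Field K] {n : ℕ}
    (G : SimpleGraph (Fin n)) (w : Sym2 (Fin n) → ℕ) :
    Ideal (MvPolynomial (Fin n) K) :=
  Ideal.span {m | ∃ i j : Fin n, G.Adj i j ∧ m = X i ^ w s(i, j) * X j ^ w s(i, j)}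

/-- The integral closure of an ideal `I`. -/
def intClosure {R : Type*} [CommRing R] (I : Ideal R) : Set R :=
  {f | ∃ k : ℕ, 0 < k ∧ ∃ c : ℕ → R,
    (∀ i ∈ Finset.Icc 1 k, c i ∈ I ^ i) ∧
    f ^ k + ∑ i ∈ Finset.Icc 1 k, c i * f ^ (k - i) = 0}

/-- An ideal is integrally closed if it equals its integral closure. -/
def IsIntClosed {R : Type*} [CommRing R] (I : Ideal R) : Prop :=
  intClosure I = ↑I

/-- An ideal is normal if all its positive powers are integrally closed. -/
def IsNormalIdeal {R : Type*} [CommRing R] (I : Ideal R) : Prop :=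
  ∀ i : ℕ, 1 ≤ i → IsIntClosed (I ^ i)

/-- `(H, wH)` is an induced (weighted) subgraph of `(G, wG)`. -/
def IsInducedWeightedSubgraph {n : ℕ} (G : SimpleGraph (Fin n)) (wG : Sym2 (Fin n) → ℕ)
    (H : SimpleGraph (Fin n)) (wH : Sym2 (Fin n) → ℕ) : Prop :=
  ∃ A : Set (Fin n), (∀ i j : Fin n, H.Adj i j ↔ (i ∈ A ∧ j ∈ A ∧ G.Adj i j)) ∧
    (∀ i j : Fin n, H.Adj i j → wH s(i, j) = wG s(i, j))

/-- An equation of integral dependence without a monic polynomial being mentioned. -/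
theorem isIntegral_of_pow_add_sum_eq_zero {A B : Type*} [CommRing A] [CommRing B] [Algebra A B]
    {x : B} {k : ℕ} (hk : 0 < k) (d : ℕ → A)
    (h : x ^ k + ∑ i ∈ Finset.Icc 1 k, algebraMap A B (d i) * x ^ (k - i) = 0) :
    IsIntegral A x := by
  refine ⟨Polynomial.X ^ k +
    ∑ i ∈ Finset.Icc 1 k, Polynomial.C (d i) * Polynomial.X ^ (k - i), ?_, ?_⟩
  · apply Polynomial.monic_X_pow_add
    rw [← Polynomial.mem_degreeLT]
    refine Submodule.sum_mem _ fun i hi => ?_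
    rw [Polynomial.mem_degreeLT]
    have hi1 := (Finset.mem_Icc.mp hi).1
    exact (Polynomial.degree_C_mul_X_pow_le _ _).trans_lt (by exact_mod_cast (by omega : k - i < k))
  · simpa [Polynomial.eval₂_finsetSum] using h

theorem subset_intClosure {R : Type*} [CommRing R] (I : Ideal R) : (I : Set R) ⊆ intClosure I := by
  intro f hf
  refine ⟨1, one_pos, fun _ => -f, ?_, by simp⟩
  intro i hi
  obtain rfl : i = 1 := by simpa using hi
  simpa using hf

theorem map_mem_intClosure {R S : Type*} [CommRing R] [CommRing S] (φ : R →+* S) {I : Ideal R}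
    {J : Ideal S} (h : I.map φ ≤ J) {f : R} (hf : f ∈ intClosure I) : φ f ∈ intClosure J := by
  obtain ⟨k, hk, c, hc, hfc⟩ := hf
  refine ⟨k, hk, fun i => φ (c i), fun i hi => ?_, ?_⟩
  · apply Ideal.pow_right_mono h i
    rw [← Ideal.map_pow]
    exact Ideal.mem_map_of_mem φ (hc i hi)
  · simpa using congrArg φ hfc

/-- If `f T` is integral over the Rees algebra of `I`, then `f` is in the integral closure
of `I`. -/
theorem mem_intClosure_of_isIntegral_reesAlgebra {R : Type*} [CommRing R] {I : Ideal R} {f : R}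
    (h : IsIntegral (reesAlgebra I) (Polynomial.monomial 1 f)) : f ∈ intClosure I := by
  cases subsingleton_or_nontrivial R
  · exact subset_intClosure I (Subsingleton.elim 0 f ▸ I.zero_mem)
  obtain ⟨p, hp, hpf⟩ := h
  have hk : 0 < p.natDegree := by
    by_contra! h0
    rw [hp.natDegree_eq_zero.mp (by omega)] at hpf
    simp at hpf
  refine ⟨p.natDegree, hk, fun i => (p.coeff (p.natDegree - i) : Polynomial R).coeff i,
    fun i _ => (p.coeff (p.natDegree - i)).2 i, ?_⟩
  have key := congrArg (fun q => Polynomial.coeff q p.natDegree) hpf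
  have hterm : ∀ j ∈ Finset.range (p.natDegree + 1),
      ((algebraMap (reesAlgebra I) (Polynomial R) (p.coeff j)) *
        Polynomial.monomial 1 f ^ j).coeff p.natDegree =
      (p.coeff j : Polynomial R).coeff (p.natDegree - j) * f ^ j := by
    intro j hj
    have hj' : j ≤ p.natDegree := by simpa [Nat.lt_succ_iff] using hj
    rw [Polynomial.monomial_pow, one_mul]
    conv_lhs => rw [← Nat.sub_add_cancel hj']
    exact Polynomial.coeff_mul_monomial _ _ _ _
  simp only [Polynomial.eval₂_eq_sum_range, Polynomial.finsetSum_coeff,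
    Polynomial.coeff_zero] at key
  rw [Finset.sum_congr rfl hterm, Finset.sum_range_succ, hp.coeff_natDegree] at key
  rw [add_comm]
  convert key using 2
  · refine Finset.sum_bij' (fun i _ => p.natDegree - i) (fun j _ => p.natDegree - j) ?_ ?_ ?_ ?_ ?_
    all_goals intro i hi; simp only [Finset.mem_Icc, Finset.mem_range] at hi ⊢
    · omega
    · omega
    · omega
    · omega
    · rw [Nat.sub_sub_self hi.2]
  · simp

/-- The coefficients of a polynomial in the integral closure of the extension of `I` lie in the
integral closure of `I`. -/
theorem coeff_mem_intClosure {R σ : Type*} [CommRing R] {I : Ideal R} {g : MvPolynomial σ R}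
    (hg : g ∈ intClosure (I.map (C : R →+* MvPolynomial σ R))) (b : σ →₀ ℕ) :
    g.coeff b ∈ intClosure I := by
  let := algebraMvPolynomial (σ := σ) (R := reesAlgebra I) (S := Polynomial R)
  obtain ⟨k, hk, c, hc, hgc⟩ := hg
  let L : ℕ → MvPolynomial σ R → MvPolynomial σ (Polynomial R) :=
    fun i q => C (Polynomial.X ^ i) * map Polynomial.C q
  have hL : ∀ i ∈ Finset.Icc 1 k, ∃ d : MvPolynomial σ (reesAlgebra I),
      algebraMap _ (MvPolynomial σ (Polynomial R)) d = L i (c i) := by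
    intro i hi
    have hci := hc i hi
    rw [← Ideal.map_pow, mem_map_C_iff] at hci
    refine ⟨∑ m ∈ (c i).support, monomial m
      ⟨Polynomial.monomial i ((c i).coeff m), reesAlgebra.monomial_mem.mpr (hci m)⟩, ?_⟩
    rw [algebraMap_def, map_sum]
    conv_rhs => rw [(c i).as_sum]
    simp only [L, map_sum, Finset.mul_sum, map_monomial, C_mul_monomial]
    refine Finset.sum_congr rfl fun m _ => ?_
    congr 1
    rw [mul_comm, Polynomial.C_mul_X_pow_eq_monomial]
    rfl
  choose! d hd using hL
  have hint : IsIntegral (MvPolynomial σ (reesAlgebra I)) (L 1 g) := by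
    refine isIntegral_of_pow_add_sum_eq_zero hk d ?_
    have := congrArg (L k) hgc
    simp only [L, map_add, map_sum, map_zero, mul_zero, mul_add, Finset.mul_sum, map_mul] at this
    refine Eq.trans (congrArg₂ (· + ·) ?_ (Finset.sum_congr rfl fun i hi => ?_)) this
    · simp [L, mul_pow]
    · have hik := (Finset.mem_Icc.mp hi).2
      rw [hd i hi]
      obtain ⟨j, rfl⟩ := Nat.exists_eq_add_of_le hik
      simp only [L, map_pow, map_mul, Nat.add_sub_cancel_left, pow_add]
      ring
  have hb := isIntegral_iff_isIntegral_coeff.mp hint b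
  apply mem_intClosure_of_isIntegral_reesAlgebra
  have hL1 : (L 1 g).coeff b = Polynomial.monomial 1 (g.coeff b) := by
    rw [coeff_C_mul, coeff_map, ← Polynomial.C_mul_X_pow_eq_monomial, mul_comm]
  rwa [hL1] at hb

/-- If `H_ω` is an induced subgraph of `G_ω` and `I(G_ω)` is normal,
then `I(H_ω)` is normal. -/
theorem edgeIdeal_induced_isNormal
    (K : Type*) [Field K] {n : ℕ} (G H : SimpleGraph (Fin n))
    (wG wH : Sym2 (Fin n) → ℕ)
    (hwG : ∀ e ∈ G.edgeSet, 1 ≤ wG e) (hwH : ∀ e ∈ H.edgeSet, 1 ≤ wH e)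
    (hind : IsInducedWeightedSubgraph G wG H wH)
    (hG : IsNormalIdeal (edgeIdeal K G wG)) :
    IsNormalIdeal (edgeIdeal K H wH) := by
  classical
  obtain ⟨A, hA, hw⟩ := hind
  intro s hs
  refine Set.Subset.antisymm (fun f hf => ?_) (subset_intClosure _)
  have hHG : edgeIdeal K H wH ≤ edgeIdeal K G wG := by
    refine Ideal.span_mono ?_
    rintro m ⟨i, j, hij, rfl⟩
    exact ⟨i, j, ((hA i j).mp hij).2.2, by rw [hw i j hij]⟩
  -- Kill the variables outside `A`.
  obtain ⟨φ, hφX⟩ : ∃ φ : MvPolynomial (Fin n) K →ₐ[K] MvPolynomial (Fin n) K,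
      ∀ i, φ (X i) = if i ∈ A then X i else 0 := ⟨aeval _, aeval_X _⟩
  have hφ : (edgeIdeal K G wG).map φ.toRingHom ≤ edgeIdeal K H wH := by
    rw [edgeIdeal, Ideal.map_span, Ideal.span_le]
    rintro _ ⟨_, ⟨i, j, hij, rfl⟩, rfl⟩
    have hne : wG s(i, j) ≠ 0 := Nat.one_le_iff_ne_zero.mp (hwG _ hij)
    by_cases hi : i ∈ A
    · by_cases hj : j ∈ A
      · have hH : H.Adj i j := (hA i j).mpr ⟨hi, hj, hij⟩
        exact Ideal.subset_span ⟨i, j, hH, by simp [hφX, hi, hj, hw i j hH]⟩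
      · simp [hφX, hj, hne]
    · simp [hφX, hi, hne]
  -- Separate the variables outside `A` from those in `A`.
  obtain ⟨δ, hδX⟩ : ∃ δ : MvPolynomial (Fin n) K →ₐ[K]
      MvPolynomial (Fin n) (MvPolynomial (Fin n) K),
      ∀ i, δ (X i) = if i ∈ A then C (X i) else X i := ⟨aeval _, aeval_X _⟩
  have hδ : (edgeIdeal K H wH).map δ.toRingHom ≤
      (edgeIdeal K H wH).map C := by
    conv_lhs => rw [edgeIdeal, Ideal.map_span]
    rw [Ideal.span_le]
    rintro _ ⟨_, ⟨i, j, hij, rfl⟩, rfl⟩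
    have hij' := (hA i j).mp hij
    have hmem : X i ^ wH s(i, j) * X j ^ wH s(i, j) ∈ edgeIdeal K H wH :=
      Ideal.subset_span ⟨i, j, hij, rfl⟩
    have := Ideal.mem_map_of_mem (C : _ →+* MvPolynomial (Fin n) (MvPolynomial (Fin n) K)) hmem
    simpa [hδX, hij'.1, hij'.2.1] using this
  have hφδ : ∀ q, map φ.toRingHom (δ q) = δ q := by
    intro q
    have : (mapAlgHom φ).comp δ = δ := by
      ext i : 1
      by_cases hi : i ∈ A <;> simp [hδX, hφX, hi]
    exact DFunLike.congr_fun this q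
  have hevδ : ∀ q, eval X (δ q) = q := by
    intro q
    have : ((aeval X : MvPolynomial (Fin n) (MvPolynomial (Fin n) K) →ₐ[_] _).restrictScalars
        K).comp δ = AlgHom.id K (MvPolynomial (Fin n) K) := by
      ext i : 1
      by_cases hi : i ∈ A <;> simp [hδX, hi]
    simpa [aeval_eq_eval] using DFunLike.congr_fun this q
  have hδf : δ f ∈ intClosure (((edgeIdeal K H wH) ^ s).map C) := by
    refine map_mem_intClosure δ.toRingHom ?_ hf
    rw [Ideal.map_pow, Ideal.map_pow]
    exact Ideal.pow_right_mono hδ s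
  have hcoeff : ∀ b, (δ f).coeff b ∈ (edgeIdeal K H wH) ^ s := by
    intro b
    have h1 := map_mem_intClosure (RingHom.id _) (J := (edgeIdeal K G wG) ^ s)
      (by simpa using Ideal.pow_right_mono hHG s) (coeff_mem_intClosure hδf b)
    rw [hG s hs] at h1
    have h2 := Ideal.mem_map_of_mem φ.toRingHom h1
    rw [Ideal.map_pow] at h2
    have h3 := Ideal.pow_right_mono hφ s h2
    rw [RingHom.id_apply, ← coeff_map, hφδ] at h3
    exact h3
  have h4 := Ideal.mem_map_of_mem (eval X) (mem_map_C_iff.mpr hcoeff)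
  rw [hevδ, Ideal.map_map] at h4
  rw [show ((eval X).comp C : MvPolynomial (Fin n) K →+* MvPolynomial (Fin n) K) =
    RingHom.id _ from RingHom.ext fun x => by simp, Ideal.map_id] at h4
  exact h4
end

section
/- Let C_ω^n be an edge-weighted cycle on vertex set [n] in which exactly three edges have non-trivial weight (weight at least 2), and let I = I(C_ω^n) be its edge ideal. If I is integrally closed, then I is normal, i.e., I^k is integrally closed for every k ≥ 1. -/
open MvPolynomial

/-- If `f` satisfies an equation of integral dependence whose `i`-th coefficient is divisible by
`p ^ (D * i)`, with `p` prime, then `p ^ D` divides `f`. -/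
theorem prime_pow_dvd_of_integral_equation {R : Type*} [CommRing R] [IsDomain R] {p f : R}
    (hp : Prime p) (D m : ℕ) (c : ℕ → R)
    (hc : ∀ i ∈ Finset.Icc 1 m, p ^ (D * i) ∣ c i)
    (h : f ^ m + ∑ i ∈ Finset.Icc 1 m, c i * f ^ (m - i) = 0) : p ^ D ∣ f := by
  suffices H : ∀ t ≤ D, p ^ t ∣ f from H D le_rfl
  intro t
  induction t with
  | zero => simp
  | succ t ih =>
    intro ht
    obtain ⟨g, rfl⟩ := ih (by omega)
    have hsum : p ^ (t * m + 1) ∣ ∑ i ∈ Finset.Icc 1 m, c i * (p ^ t * g) ^ (m - i) := by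
      refine Finset.dvd_sum fun i hi => ?_
      have hi' := Finset.mem_Icc.1 hi
      have hexp : t * m + 1 ≤ D * i + t * (m - i) := by
        obtain ⟨r, rfl⟩ := Nat.exists_eq_add_of_le hi'.2
        rw [Nat.add_sub_cancel_left]
        nlinarith [Nat.mul_le_mul_right i ht]
      refine (pow_dvd_pow p hexp).trans ?_
      rw [pow_add, mul_pow, ← pow_mul]
      exact mul_dvd_mul (hc i hi) (dvd_mul_right _ _)
    have hpow : p ^ (t * m + 1) ∣ (p ^ t * g) ^ m := by
      rw [eq_neg_of_add_eq_zero_left h]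
      exact hsum.neg_right
    rw [mul_pow, ← pow_mul, pow_succ] at hpow
    have hg := hp.dvd_of_dvd_pow
      ((mul_dvd_mul_iff_left (pow_ne_zero _ hp.ne_zero)).1 hpow)
    rw [pow_succ]
    exact mul_dvd_mul_left _ hg

/-- The homomorphism `X i ↦ X i * T ^ l i` recording the `l`-weighted degree in the powers of
the new variable `T`. -/
noncomputable def weightHom (K : Type*) [Field K] {σ : Type*} (l : σ → ℕ) :
    MvPolynomial σ K →ₐ[K] Polynomial (MvPolynomial σ K) :=
  aeval fun i => Polynomial.C (X i) * Polynomial.X ^ l i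

theorem weightHom_monomial {K : Type*} [Field K] {σ : Type*} [Fintype σ] (l : σ → ℕ)
    (u : σ →₀ ℕ) (a : K) :
    weightHom K l (monomial u a) =
      Polynomial.C (monomial u a) * Polynomial.X ^ (∑ i, l i * u i) := by
  have h : algebraMap K (Polynomial (MvPolynomial σ K)) a = Polynomial.C (C a) := rfl
  rw [weightHom, aeval_monomial, monomial_eq, Finsupp.prod_fintype _ _ (by simp),
    Finsupp.prod_fintype _ _ (by simp), h]
  simp [mul_pow, Finset.prod_mul_distrib, ← pow_mul, Finset.prod_pow_eq_pow_sum, mul_assoc]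

theorem coeff_coeff_weightHom {K : Type*} [Field K] {σ : Type*} [Fintype σ] (l : σ → ℕ)
    (f : MvPolynomial σ K) (u : σ →₀ ℕ) :
    coeff u ((weightHom K l f).coeff (∑ i, l i * u i)) = coeff u f := by
  induction f using MvPolynomial.induction_on' with
  | monomial v a =>
    classical
    rw [weightHom_monomial, Polynomial.coeff_C_mul_X_pow]
    by_cases huv : v = u
    · simp [huv]
    · split_ifs <;> simp [coeff_monomial, huv]
  | add p q hp hq => simp [hp, hq]

/-- Linear inequalities on the exponents of a monomial ideal persist in the integral closure of
its powers. -/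
theorem le_weight_of_mem_intClosure_pow {K : Type*} [Field K] {σ : Type*} [Fintype σ]
    {S : Set (MvPolynomial σ K)} {l : σ → ℕ} {d k : ℕ}
    (hS : ∀ m ∈ S, Polynomial.X ^ d ∣ weightHom K l m)
    {f : MvPolynomial σ K} (hf : f ∈ intClosure (Ideal.span S ^ k))
    {u : σ →₀ ℕ} (hu : u ∈ f.support) : k * d ≤ ∑ i, l i * u i := by
  obtain ⟨m, -, c, hc, h⟩ := hf
  have hle : Ideal.span S ≤ (Ideal.span {Polynomial.X ^ d}).comap (weightHom K l) :=
    Ideal.span_le.2 fun s hs => Ideal.mem_span_singleton.2 (hS s hs)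
  have hpow : ∀ j, ∀ g ∈ Ideal.span S ^ j, Polynomial.X ^ (d * j) ∣ weightHom K l g := by
    intro j g hg
    have := Ideal.le_comap_pow (weightHom K l) j (Ideal.pow_right_mono hle j hg)
    rwa [Ideal.mem_comap, Ideal.span_singleton_pow, Ideal.mem_span_singleton, ← pow_mul] at this
  have hdvd : Polynomial.X ^ (d * k) ∣ weightHom K l f := by
    refine prime_pow_dvd_of_integral_equation Polynomial.prime_X (d * k) m
      (fun i => weightHom K l (c i)) (fun i hi => ?_) ?_
    · rw [mul_assoc]
      refine hpow _ _ ?_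
      rw [pow_mul]
      exact hc i hi
    · simpa using congrArg (weightHom K l) h
  by_contra! hlt
  refine mem_support_iff.1 hu ?_
  rw [← coeff_coeff_weightHom l, Polynomial.X_pow_dvd_iff.1 hdvd _ (by rwa [mul_comm]), coeff_zero]

theorem mem_of_forall_monomial_mem {K σ : Type*} [Field K] {I : Ideal (MvPolynomial σ K)}
    {f : MvPolynomial σ K} (h : ∀ u ∈ f.support, monomial u 1 ∈ I) : f ∈ I := by
  rw [f.as_sum]
  refine sum_mem fun u hu => ?_
  rw [← mul_one (coeff u f), ← C_mul_monomial]
  exact I.mul_mem_left _ (h u hu)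

/-- The case of the rounding property in which the cheapest vertex cover misses the edge of
weight `a`. -/
theorem exists_hexagon_packing_of_le {a b c : ℕ} (ha : 2 ≤ a) (hb : 2 ≤ b) (hc : 2 ≤ c)
    {u₀ u₁ u₂ u₃ u₄ u₅ k : ℕ}
    (H : ∀ l₀ l₁ l₂ l₃ l₄ l₅ d : ℕ, d ≤ a * (l₀ + l₁) → d ≤ l₁ + l₂ → d ≤ b * (l₂ + l₃) →
      d ≤ l₃ + l₄ → d ≤ c * (l₄ + l₅) → d ≤ l₅ + l₀ →
      k * d ≤ l₀ * u₀ + l₁ * u₁ + l₂ * u₂ + l₃ * u₃ + l₄ * u₄ + l₅ * u₅)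
    (h₁ : u₂ ≤ u₁) (h₂ : u₅ ≤ u₀) :
    ∃ n₀ n₁ n₂ n₃ n₄ n₅ : ℕ, k ≤ n₀ + n₁ + n₂ + n₃ + n₄ + n₅ ∧
      a * n₀ + n₅ ≤ u₀ ∧ a * n₀ + n₁ ≤ u₁ ∧ n₁ + b * n₂ ≤ u₂ ∧ b * n₂ + n₃ ≤ u₃ ∧
      n₃ + c * n₄ ≤ u₄ ∧ c * n₄ + n₅ ≤ u₅ := by
  obtain ⟨r, rfl⟩ := Nat.exists_eq_add_of_le ha
  set p := min (u₁ - u₂) (u₀ - u₅) with hp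
  have hdiv : (2 + r) * (p / (2 + r)) ≤ p := Nat.mul_div_le _ _
  refine ⟨p / (2 + r), u₂, 0, min u₃ u₄, 0, u₅, ?_, by omega, by omega, by omega, by omega,
    by omega, by omega⟩
  have key : (2 + r) * k ≤ p + (2 + r) * (u₂ + u₅ + min u₃ u₄) := by
    rcases le_total (u₁ - u₂) (u₀ - u₅) with h | h <;> rcases le_total u₃ u₄ with h' | h'
    · have := H 0 1 (1 + r) (2 + r) 0 (2 + r) (2 + r) (by nlinarith) (by omega) (by nlinarith)
        (by omega) (by nlinarith) (by omega)
      rw [hp, min_eq_left h, min_eq_left h']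
      zify [h₁] at *
      linarith
    · have := H 0 1 (1 + r) 0 (2 + r) (2 + r) (2 + r) (by nlinarith) (by omega) (by nlinarith)
        (by omega) (by nlinarith) (by omega)
      rw [hp, min_eq_left h, min_eq_right h']
      zify [h₁] at *
      linarith
    · have := H 1 0 (2 + r) (2 + r) 0 (1 + r) (2 + r) (by nlinarith) (by omega) (by nlinarith)
        (by omega) (by nlinarith) (by omega)
      rw [hp, min_eq_right h, min_eq_left h']
      zify [h₂] at *
      linarith
    · have := H 1 0 (2 + r) 0 (2 + r) (1 + r) (2 + r) (by nlinarith) (by omega) (by nlinarith)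
        (by omega) (by nlinarith) (by omega)
      rw [hp, min_eq_right h, min_eq_right h']
      zify [h₂] at *
      linarith
  have hq : k - (u₂ + u₅ + min u₃ u₄) ≤ p / (2 + r) := by
    rw [Nat.le_div_iff_mul_le (by omega), Nat.sub_mul]
    rw [tsub_le_iff_right]
    linarith
  omega

/-- Rounding property of the alternately weighted hexagon: if every fractional cover of the edges
has cost at least `k`, then `k` edges can be packed into `u`. -/
theorem exists_hexagon_packing {a b c : ℕ} (ha : 2 ≤ a) (hb : 2 ≤ b) (hc : 2 ≤ c)
    {u₀ u₁ u₂ u₃ u₄ u₅ k : ℕ}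
    (H : ∀ l₀ l₁ l₂ l₃ l₄ l₅ d : ℕ, d ≤ a * (l₀ + l₁) → d ≤ l₁ + l₂ → d ≤ b * (l₂ + l₃) →
      d ≤ l₃ + l₄ → d ≤ c * (l₄ + l₅) → d ≤ l₅ + l₀ →
      k * d ≤ l₀ * u₀ + l₁ * u₁ + l₂ * u₂ + l₃ * u₃ + l₄ * u₄ + l₅ * u₅) :
    ∃ n₀ n₁ n₂ n₃ n₄ n₅ : ℕ, k ≤ n₀ + n₁ + n₂ + n₃ + n₄ + n₅ ∧
      a * n₀ + n₅ ≤ u₀ ∧ a * n₀ + n₁ ≤ u₁ ∧ n₁ + b * n₂ ≤ u₂ ∧ b * n₂ + n₃ ≤ u₃ ∧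
      n₃ + c * n₄ ≤ u₄ ∧ c * n₄ + n₅ ≤ u₅ := by
  by_cases hA : u₂ ≤ u₁ ∧ u₅ ≤ u₀
  · exact exists_hexagon_packing_of_le ha hb hc H hA.1 hA.2
  by_cases hB : u₄ ≤ u₃ ∧ u₁ ≤ u₂
  · obtain ⟨n₀, n₁, n₂, n₃, n₄, n₅, h⟩ := exists_hexagon_packing_of_le hb hc ha
      (k := k) (u₀ := u₂) (u₁ := u₃) (u₂ := u₄) (u₃ := u₅) (u₄ := u₀) (u₅ := u₁)
      (fun l₀ l₁ l₂ l₃ l₄ l₅ d h₀ h₁ h₂ h₃ h₄ h₅ =>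
        (H l₄ l₅ l₀ l₁ l₂ l₃ d h₄ h₅ h₀ h₁ h₂ h₃).trans (by linarith)) hB.1 hB.2
    exact ⟨n₄, n₅, n₀, n₁, n₂, n₃, by omega⟩
  by_cases hC : u₀ ≤ u₅ ∧ u₃ ≤ u₄
  · obtain ⟨n₀, n₁, n₂, n₃, n₄, n₅, h⟩ := exists_hexagon_packing_of_le hc ha hb
      (k := k) (u₀ := u₄) (u₁ := u₅) (u₂ := u₀) (u₃ := u₁) (u₄ := u₂) (u₅ := u₃)
      (fun l₀ l₁ l₂ l₃ l₄ l₅ d h₀ h₁ h₂ h₃ h₄ h₅ =>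
        (H l₂ l₃ l₄ l₅ l₀ l₁ d h₂ h₃ h₄ h₅ h₀ h₁).trans (by linarith)) hC.1 hC.2
    exact ⟨n₂, n₃, n₄, n₅, n₀, n₁, by omega⟩
  refine ⟨0, min u₁ u₂, 0, min u₃ u₄, 0, min u₅ u₀, ?_, by omega, by omega, by omega, by omega,
    by omega, by omega⟩
  have h₀ := H 1 0 1 0 1 0 1 (by omega) (by omega) (by omega) (by omega) (by omega) (by omega)
  have h₁ := H 0 1 0 1 0 1 1 (by omega) (by omega) (by omega) (by omega) (by omega) (by omega)
  omega

theorem edgeIdeal_eq_span_monomial (K : Type*) [Field K] {n : ℕ} (G : SimpleGraph (Fin n))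
    (w : Sym2 (Fin n) → ℕ) :
    edgeIdeal K G w = Ideal.span ((fun s => monomial s (1 : K)) ''
      {e | ∃ i j : Fin n, G.Adj i j ∧
        e = Finsupp.single i (w s(i, j)) + Finsupp.single j (w s(i, j))}) := by
  have h : ∀ i j : Fin n, monomial (Finsupp.single i (w s(i, j)) + Finsupp.single j (w s(i, j)))
      (1 : K) = X i ^ w s(i, j) * X j ^ w s(i, j) := by
    intro i j
    rw [X_pow_eq_monomial, X_pow_eq_monomial, monomial_mul, one_mul]
  unfold edgeIdeal
  congr 1
  ext m
  constructor
  · rintro ⟨i, j, hij, rfl⟩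
    exact ⟨_, ⟨i, j, hij, rfl⟩, h i j⟩
  · rintro ⟨_, ⟨i, j, hij, rfl⟩, rfl⟩
    exact ⟨i, j, hij, h i j⟩

theorem pow_mul_pow_mem_edgeIdeal (K : Type*) [Field K] {n : ℕ} {G : SimpleGraph (Fin n)}
    (w : Sym2 (Fin n) → ℕ) {i j : Fin n} (h : G.Adj i j) {p : ℕ} (hp : w s(i, j) ≤ p) :
    X i ^ p * X j ^ p ∈ edgeIdeal K G w := by
  refine Ideal.mem_of_dvd _ (mul_dvd_mul (pow_dvd_pow _ hp) (pow_dvd_pow _ hp)) ?_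
  exact Ideal.subset_span ⟨i, j, h, rfl⟩

/-- In an integrally closed edge ideal, two edges of non-trivial weight always span a third edge,
which is lighter than one of them. -/
theorem exists_adj_of_isIntClosed {K : Type*} [Field K] {n : ℕ} {G : SimpleGraph (Fin n)}
    {w : Sym2 (Fin n) → ℕ} (hw : ∀ e ∈ G.edgeSet, 1 ≤ w e)
    (hic : IsIntClosed (edgeIdeal K G w)) {a b c d : Fin n}
    (hab : G.Adj a b) (hcd : G.Adj c d) (hp : 2 ≤ w s(a, b)) (hq : 2 ≤ w s(c, d))
    (hne : s(a, b) ≠ s(c, d)) :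
    ∃ s t : Fin n, G.Adj s t ∧ s(s, t) ≠ s(a, b) ∧ s(s, t) ≠ s(c, d) ∧
      (s = a ∨ s = b ∨ s = c ∨ s = d) ∧ (t = a ∨ t = b ∨ t = c ∨ t = d) ∧
      w s(s, t) < max (w s(a, b)) (w s(c, d)) := by
  obtain ⟨p, hp'⟩ : ∃ p, p = (w s(a, b) + 1) / 2 := ⟨_, rfl⟩
  obtain ⟨q, hq'⟩ : ∃ q, q = (w s(c, d) + 1) / 2 := ⟨_, rfl⟩
  set E : Fin n →₀ ℕ :=
    Finsupp.single a p + Finsupp.single b p + (Finsupp.single c q + Finsupp.single d q) with hE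
  have hEm : monomial E (1 : K) = X a ^ p * X b ^ p * (X c ^ q * X d ^ q) := by
    simp only [X_pow_eq_monomial, monomial_mul, one_mul, hE]
  have hsq : monomial E (1 : K) ^ 2 ∈ edgeIdeal K G w ^ 2 := by
    have h := Ideal.mul_mem_mul
      (pow_mul_pow_mem_edgeIdeal K w hab (p := 2 * p) (by omega))
      (pow_mul_pow_mem_edgeIdeal K w hcd (p := 2 * q) (by omega))
    rw [← pow_two] at h
    convert h using 1
    rw [hEm]
    ring
  have hmem : monomial E (1 : K) ∈ edgeIdeal K G w := by
    rw [← SetLike.mem_coe, ← hic]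
    refine ⟨2, two_pos, fun i => if i = 2 then -monomial E (1 : K) ^ 2 else 0, ?_, ?_⟩
    · intro i hi
      dsimp only
      split_ifs with h
      · subst h
        exact neg_mem hsq
      · exact zero_mem _
    · simp
  rw [edgeIdeal_eq_span_monomial, mem_ideal_span_monomial_image] at hmem
  obtain ⟨_, ⟨s, t, hst, rfl⟩, hle⟩ := hmem E (by simp [mem_support_iff])
  have hpos := hw _ ((G.mem_edgeSet).2 hst)
  have hs := hle s
  have ht := hle t
  have h₁ := hst.ne
  have h₂ := hab.ne
  have h₃ := hcd.ne
  simp only [hE, Finsupp.add_apply, Finsupp.single_apply, if_neg h₁, if_neg h₁.symm, if_true]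
    at hs ht
  have hlt : w s(s, t) < max (w s(a, b)) (w s(c, d)) := by
    rw [lt_max_iff]
    simp only [ne_eq, Sym2.eq_iff] at hne
    grind
  have hsab : s(s, t) ≠ s(a, b) := by
    intro h
    rw [h] at hs ht
    simp only [ne_eq, Sym2.eq_iff] at hne h
    grind
  have hscd : s(s, t) ≠ s(c, d) := by
    intro h
    rw [h] at hs ht
    simp only [ne_eq, Sym2.eq_iff] at hne h
    grind
  exact ⟨s, t, hst, hsab, hscd, by grind, by grind, hlt⟩

theorem isIntClosed_edgeIdeal_hexagon_pow {K : Type*} [Field K] {G : SimpleGraph (Fin 6)}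
    {w : Sym2 (Fin 6) → ℕ} (hG : ∀ s t, G.Adj s t ↔ t = s + 1 ∨ s = t + 1) (i : Fin 6)
    (h₀ : 2 ≤ w s(i, i + 1)) (h₁ : w s(i + 1, i + 2) = 1) (h₂ : 2 ≤ w s(i + 2, i + 3))
    (h₃ : w s(i + 3, i + 4) = 1) (h₄ : 2 ≤ w s(i + 4, i + 5)) (h₅ : w s(i + 5, i) = 1) (k : ℕ) :
    IsIntClosed (edgeIdeal K G w ^ k) := by
  refine Set.Subset.antisymm (fun f hf => mem_of_forall_monomial_mem fun u hu => ?_)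
    (subset_intClosure _)
  have hsum : ∀ {M : Type} [AddCommMonoid M] (g : Fin 6 → M), ∑ x, g x =
      g i + g (i + 1) + g (i + 2) + g (i + 3) + g (i + 4) + g (i + 5) := by
    intro M _ g
    rw [← Equiv.sum_comp (Equiv.addLeft i) g, Fin.sum_univ_six]
    simp
  have hcover : ∀ z : Fin 6, ∃ y : Fin 6, z = i + y := fun z => ⟨z - i, by abel⟩
  obtain ⟨n₀, n₁, n₂, n₃, n₄, n₅, hk, e₀, e₁, e₂, e₃, e₄, e₅⟩ := exists_hexagon_packing h₀ h₂ h₄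
    (u₀ := u i) (u₁ := u (i + 1)) (u₂ := u (i + 2)) (u₃ := u (i + 3)) (u₄ := u (i + 4))
    (u₅ := u (i + 5)) (k := k) (by
      intro l₀ l₁ l₂ l₃ l₄ l₅ d g₀ g₁ g₂ g₃ g₄ g₅
      have H := le_weight_of_mem_intClosure_pow (l := fun x => ![l₀, l₁, l₂, l₃, l₄, l₅] (x - i))
        (d := d) ?_ hf hu
      · rw [hsum] at H
        simpa using H
      have hedge : ∀ s : Fin 6, d ≤ w s(s, s + 1) *
          (![l₀, l₁, l₂, l₃, l₄, l₅] (s - i) + ![l₀, l₁, l₂, l₃, l₄, l₅] (s + 1 - i)) := by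
        intro s
        obtain ⟨y, rfl⟩ := hcover s
        have hy : i + y + 1 - i = y + 1 := by abel
        rw [add_sub_cancel_left, hy, add_assoc]
        fin_cases y
        · simpa using g₀
        · simpa [h₁] using g₁
        · simpa using g₂
        · simpa [h₃] using g₃
        · simpa using g₄
        · simpa [h₅] using g₅
      rintro _ ⟨s, t, hst, rfl⟩
      have hval : weightHom K (fun x => ![l₀, l₁, l₂, l₃, l₄, l₅] (x - i))
          (X s ^ w s(s, t) * X t ^ w s(s, t)) =
          Polynomial.C (X s ^ w s(s, t) * X t ^ w s(s, t)) * Polynomial.X ^ (w s(s, t) *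
            (![l₀, l₁, l₂, l₃, l₄, l₅] (s - i) + ![l₀, l₁, l₂, l₃, l₄, l₅] (t - i))) := by
        simp only [weightHom, map_mul, map_pow, aeval_X]
        ring
      rw [hval]
      refine Dvd.dvd.mul_left (pow_dvd_pow _ ?_) _
      rcases (hG s t).1 hst with rfl | rfl
      · exact hedge s
      · rw [Sym2.eq_swap, add_comm (![l₀, l₁, l₂, l₃, l₄, l₅] _)]
        exact hedge t)
  have hadj : ∀ s t : Fin 6, t = s + 1 →
      X s ^ w s(s, t) * X t ^ w s(s, t) ∈ edgeIdeal K G w := fun s t h =>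
    pow_mul_pow_mem_edgeIdeal K w ((hG s t).2 (Or.inl h)) le_rfl
  have hmem := Ideal.mul_mem_mul (Ideal.mul_mem_mul (Ideal.mul_mem_mul (Ideal.mul_mem_mul
    (Ideal.mul_mem_mul
      (Ideal.pow_mem_pow (hadj i (i + 1) rfl) n₀)
      (Ideal.pow_mem_pow (hadj (i + 1) (i + 2) (by rw [add_assoc]; rfl)) n₁))
      (Ideal.pow_mem_pow (hadj (i + 2) (i + 3) (by rw [add_assoc]; rfl)) n₂))
      (Ideal.pow_mem_pow (hadj (i + 3) (i + 4) (by rw [add_assoc]; rfl)) n₃))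
      (Ideal.pow_mem_pow (hadj (i + 4) (i + 5) (by rw [add_assoc]; rfl)) n₄))
      (Ideal.pow_mem_pow (hadj (i + 5) i (by rw [add_assoc]; exact (add_zero i).symm)) n₅)
  rw [h₁, h₃, h₅] at hmem
  simp only [← pow_add] at hmem
  refine Ideal.pow_le_pow_right hk (Ideal.mem_of_dvd _ ?_ hmem)
  have hprod : monomial u (1 : K) = X i ^ u i * X (i + 1) ^ u (i + 1) * X (i + 2) ^ u (i + 2) *
      X (i + 3) ^ u (i + 3) * X (i + 4) ^ u (i + 4) * X (i + 5) ^ u (i + 5) := by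
    rw [monomial_eq, Finsupp.prod_fintype _ _ (by simp), C_1, one_mul,
      ← Equiv.prod_comp (Equiv.addLeft i), Fin.prod_univ_six]
    simp
  rw [hprod]
  refine dvd_trans (dvd_of_eq ?_) (mul_dvd_mul (mul_dvd_mul (mul_dvd_mul (mul_dvd_mul
    (mul_dvd_mul (pow_dvd_pow _ e₀) (pow_dvd_pow _ e₁)) (pow_dvd_pow _ e₂))
    (pow_dvd_pow _ e₃)) (pow_dvd_pow _ e₄)) (pow_dvd_pow _ e₅))
  ring

theorem adj_iff_add_one {n : ℕ} [NeZero n] {G : SimpleGraph (Fin n)}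
    (hG : ∀ i j : Fin n, G.Adj i j ↔
      ((i.val + 1) % n = j.val ∨ (j.val + 1) % n = i.val)) (s t : Fin n) :
    G.Adj s t ↔ t = s + 1 ∨ s = t + 1 := by
  have h : ∀ x : Fin n, (x + 1).val = (x.val + 1) % n := fun x => by
    rw [Fin.val_add, Fin.val_one', Nat.add_mod_mod]
  rw [hG, Fin.ext_iff, Fin.ext_iff, h, h]
  exact or_congr eq_comm eq_comm

theorem add_one_add_one_ne {n : ℕ} [NeZero n] (hn : 3 ≤ n) (x : Fin n) : x + 1 + 1 ≠ x := by
  intro h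
  rw [add_assoc, add_eq_left, Fin.ext_iff, Fin.val_add, Fin.val_one',
    Nat.mod_eq_of_lt (show 1 < n by omega), Nat.mod_eq_of_lt (show 1 + 1 < n by omega)] at h
  simp at h

/-- Two edges of non-trivial weight in an integrally closed cycle are at distance two. -/
theorem eq_add_two_of_isIntClosed {K : Type*} [Field K] {n : ℕ} [NeZero n] (hn : 3 ≤ n)
    {G : SimpleGraph (Fin n)} {w : Sym2 (Fin n) → ℕ}
    (hG : ∀ s t, G.Adj s t ↔ t = s + 1 ∨ s = t + 1) (hw : ∀ e ∈ G.edgeSet, 1 ≤ w e)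
    (hic : IsIntClosed (edgeIdeal K G w)) {i j : Fin n} (hi : 2 ≤ w s(i, i + 1))
    (hj : 2 ≤ w s(j, j + 1)) (hij : s(i, i + 1) ≠ s(j, j + 1)) :
    (j = i + 1 + 1 ∧ w s(i + 1, j) < max (w s(i, i + 1)) (w s(j, j + 1))) ∨
      (i = j + 1 + 1 ∧ w s(j + 1, i) < max (w s(i, i + 1)) (w s(j, j + 1))) := by
  obtain ⟨g, hgi, hgj, hg, hg', hlt⟩ : ∃ g, g ≠ i ∧ g ≠ j ∧
      (g = i ∨ g = i + 1 ∨ g = j ∨ g = j + 1) ∧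
      (g + 1 = i ∨ g + 1 = i + 1 ∨ g + 1 = j ∨ g + 1 = j + 1) ∧
      w s(g, g + 1) < max (w s(i, i + 1)) (w s(j, j + 1)) := by
    obtain ⟨s, t, hst, h₁, h₂, hs, ht, hlt⟩ := exists_adj_of_isIntClosed hw hic
      ((hG i (i + 1)).2 (Or.inl rfl)) ((hG j (j + 1)).2 (Or.inl rfl)) hi hj hij
    rcases (hG s t).1 hst with rfl | rfl
    · exact ⟨s, fun h => h₁ (by rw [h]), fun h => h₂ (by rw [h]), hs, ht, hlt⟩
    · rw [Sym2.eq_swap] at h₁ h₂ hlt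
      exact ⟨t, fun h => h₁ (by rw [h]), fun h => h₂ (by rw [h]), ht, hs, hlt⟩
  have hinj : ∀ {x y : Fin n}, x + 1 = y + 1 → x = y := fun h => add_right_cancel h
  rcases hg with rfl | rfl | rfl | rfl
  · exact absurd rfl hgi
  · rcases hg' with h | h | h | h
    · exact absurd h (add_one_add_one_ne hn i)
    · exact absurd (hinj h) hgi
    · subst h
      exact Or.inl ⟨rfl, hlt⟩
    · exact absurd (hinj h) hgj
  · exact absurd rfl hgj
  · rcases hg' with h | h | h | h
    · subst h
      exact Or.inr ⟨rfl, hlt⟩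
    · exact absurd (hinj h) hgi
    · exact absurd h (add_one_add_one_ne hn j)
    · exact absurd (hinj h) hgj

theorem dvd_six_of_add_six_eq {n : ℕ} [NeZero n] {i : Fin n}
    (h : i + 1 + 1 + 1 + 1 + 1 + 1 = i) : n ∣ 6 := by
  simp only [add_assoc, add_eq_left] at h
  have := congrArg Fin.val h
  simpa [Nat.dvd_iff_mod_eq_zero, Fin.val_add] using this

/-- The nontrivial edges `{i, i + 1}`, `{i + 2, i + 3}`, `{i + 4, i + 5}` force a hexagon. -/
theorem isIntClosed_pow_of_consecutive {K : Type*} [Field K] {n : ℕ} [inst : NeZero n] (hn : 3 ≤ n)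
    {G : SimpleGraph (Fin n)} {w : Sym2 (Fin n) → ℕ}
    (hG : ∀ s t, G.Adj s t ↔ t = s + 1 ∨ s = t + 1) (hw : ∀ e ∈ G.edgeSet, 1 ≤ w e)
    (hic : IsIntClosed (edgeIdeal K G w)) {i j l : Fin n}
    (hT : ∀ x, 2 ≤ w s(x, x + 1) → x = i ∨ x = j ∨ x = l)
    (hi : 2 ≤ w s(i, i + 1)) (hj : 2 ≤ w s(j, j + 1)) (hl : 2 ≤ w s(l, l + 1))
    (hij : s(i, i + 1) ≠ s(j, j + 1)) (hjl : s(j, j + 1) ≠ s(l, l + 1))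
    (hli : s(l, l + 1) ≠ s(i, i + 1))
    (hj' : j = i + 1 + 1) (hl' : l = j + 1 + 1) (hi' : i = l + 1 + 1) (k : ℕ) :
    IsIntClosed (edgeIdeal K G w ^ k) := by
  have hdvd : n ∣ 6 := dvd_six_of_add_six_eq (i := i) (by rw [← hj', ← hl', ← hi'])
  have hn' : n = 3 ∨ n = 6 := by
    have := Nat.le_of_dvd (by norm_num) hdvd
    interval_cases n <;> omega
  rcases hn' with rfl | rfl
  · have h₁ := eq_add_two_of_isIntClosed hn hG hw hic hi hj hij
    have h₂ := eq_add_two_of_isIntClosed hn hG hw hic hj hl hjl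
    have h₃ := eq_add_two_of_isIntClosed hn hG hw hic hl hi hli
    have e₁ : i + 1 = l := by subst hj' hl'; fin_cases i <;> rfl
    have e₂ : j + 1 = i := by subst hj'; fin_cases i <;> rfl
    have e₃ : l + 1 = j := by rw [← e₁]; exact hj'.symm
    have a₁ : i ≠ j + 1 + 1 := by rw [e₂, e₁]; rintro rfl; exact hli rfl
    have a₂ : j ≠ l + 1 + 1 := by rw [e₃, e₂]; rintro rfl; exact hij rfl
    have a₃ : l ≠ i + 1 + 1 := by rw [e₁, e₃]; rintro rfl; exact hjl rfl
    rw [e₁, e₂] at h₁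
    rw [e₂, e₃] at h₂
    rw [e₃, e₁] at h₃
    rw [e₂] at a₁
    rw [e₃] at a₂
    rw [e₁] at a₃
    have b₁ := (h₁.resolve_right fun h => a₁ h.1).2
    have b₂ := (h₂.resolve_right fun h => a₂ h.1).2
    have b₃ := (h₃.resolve_right fun h => a₃ h.1).2
    omega
  · obtain rfl : inst = ⟨by norm_num⟩ := Subsingleton.elim _ _
    have htriv : ∀ x, x ≠ i → x ≠ j → x ≠ l → w s(x, x + 1) = 1 := by
      intro x hxi hxj hxl
      have := hw _ (G.mem_edgeSet.2 ((hG x (x + 1)).2 (Or.inl rfl)))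
      have := mt (hT x) (by tauto)
      omega
    clear hT hij hjl hli hi' hdvd
    have ej : j = i + 2 := by rw [hj', add_assoc]; rfl
    have el : l = i + 4 := by rw [hl', ej, add_assoc, add_assoc]; rfl
    subst ej el
    have hne : ∀ y : Fin 6, y ≠ 0 → y ≠ 2 → y ≠ 4 → w s(i + y, i + y + 1) = 1 := by
      intro y h₀ h₂ h₄
      exact htriv _ (by simpa using h₀) (by simpa using h₂) (by simpa using h₄)
    have h₁ := hne 1 (by decide) (by decide) (by decide)
    have h₃ := hne 3 (by decide) (by decide) (by decide)
    have h₅ := hne 5 (by decide) (by decide) (by decide)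
    rw [add_assoc] at h₁ h₃ h₅ hj hl
    have h₆ : i + (5 + 1) = i := add_zero i
    rw [h₆] at h₅
    exact isIntClosed_edgeIdeal_hexagon_pow hG i hi h₁ hj h₃ hl h₅ k

/-- Let `C_ω^n` be an edge-weighted cycle on `[n]` (vertex `i` adjacent to `i+1 mod n`)
with exactly three edges of non-trivial weight (weight ≥ 2). If its edge ideal is
integrally closed, then it is normal: every power `I^k`, `k ≥ 1`, is integrally
closed. -/
theorem edgeIdeal_cycle_three_nontrivial_normal_of_intClosed
    (K : Type*) [Field K] {n : ℕ} (hn : 3 ≤ n)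
    (G : SimpleGraph (Fin n)) (w : Sym2 (Fin n) → ℕ)
    (hG : ∀ i j : Fin n, G.Adj i j ↔
      ((i.val + 1) % n = j.val ∨ (j.val + 1) % n = i.val))
    (hw : ∀ e ∈ G.edgeSet, 1 ≤ w e)
    (h3 : {e ∈ G.edgeSet | 2 ≤ w e}.ncard = 3)
    (hic : IsIntClosed (edgeIdeal K G w)) :
    ∀ k : ℕ, 1 ≤ k → IsIntClosed (edgeIdeal K G w ^ k) := by
  intro k _
  have : NeZero n := ⟨by omega⟩
  have hadj := adj_iff_add_one hG
  have hrep : ∀ e ∈ G.edgeSet, ∃ i, e = s(i, i + 1) := by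
    intro e
    induction e with
    | h s t =>
      intro he
      rcases (hadj s t).1 (G.mem_edgeSet.1 he) with rfl | rfl
      · exact ⟨s, rfl⟩
      · exact ⟨t, Sym2.eq_swap⟩
  obtain ⟨e₁, e₂, e₃, h₁₂, h₁₃, h₂₃, hset⟩ := Set.ncard_eq_three.1 h3
  have m₁ : e₁ ∈ {e ∈ G.edgeSet | 2 ≤ w e} := by simp [hset]
  have m₂ : e₂ ∈ {e ∈ G.edgeSet | 2 ≤ w e} := by simp [hset]
  have m₃ : e₃ ∈ {e ∈ G.edgeSet | 2 ≤ w e} := by simp [hset]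
  obtain ⟨i, rfl⟩ := hrep e₁ m₁.1
  obtain ⟨j, rfl⟩ := hrep e₂ m₂.1
  obtain ⟨l, rfl⟩ := hrep e₃ m₃.1
  have hinj : ∀ x y : Fin n, s(x, x + 1) = s(y, y + 1) → x = y := by
    intro x y h
    rcases Sym2.eq_iff.1 h with h | ⟨rfl, h⟩
    · exact h.1
    · exact absurd h (add_one_add_one_ne hn y)
  have hT : ∀ x, 2 ≤ w s(x, x + 1) → x = i ∨ x = j ∨ x = l := by
    intro x hx
    have hmem : s(x, x + 1) ∈ {e ∈ G.edgeSet | 2 ≤ w e} :=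
      ⟨G.mem_edgeSet.2 ((hadj x (x + 1)).2 (Or.inl rfl)), hx⟩
    rw [hset] at hmem
    rcases hmem with h | h | h
    · exact Or.inl (hinj _ _ h)
    · exact Or.inr (Or.inl (hinj _ _ h))
    · exact Or.inr (Or.inr (hinj _ _ h))
  have d₁₂ := eq_add_two_of_isIntClosed hn hadj hw hic m₁.2 m₂.2 h₁₂
  have d₁₃ := eq_add_two_of_isIntClosed hn hadj hw hic m₁.2 m₃.2 h₁₃
  have d₂₃ := eq_add_two_of_isIntClosed hn hadj hw hic m₂.2 m₃.2 h₂₃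
  have hcyc : (j = i + 1 + 1 ∧ l = j + 1 + 1 ∧ i = l + 1 + 1) ∨
      (l = i + 1 + 1 ∧ j = l + 1 + 1 ∧ i = j + 1 + 1) := by
    have hc : ∀ {x y : Fin n}, x + 1 + 1 = y + 1 + 1 → x = y := fun h =>
      add_right_cancel (add_right_cancel h)
    have n₁₂ : i ≠ j := fun h => h₁₂ (by rw [h])
    have n₁₃ : i ≠ l := fun h => h₁₃ (by rw [h])
    have n₂₃ : j ≠ l := fun h => h₂₃ (by rw [h])
    grind
  rcases hcyc with ⟨hj, hl, hi⟩ | ⟨hl, hj, hi⟩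
  · exact isIntClosed_pow_of_consecutive hn hadj hw hic hT m₁.2 m₂.2 m₃.2 h₁₂ h₂₃ h₁₃.symm
      hj hl hi k
  · exact isIntClosed_pow_of_consecutive hn hadj hw hic (fun x hx => by have := hT x hx; tauto)
      m₁.2 m₃.2 m₂.2 h₁₃ h₂₃.symm h₁₂.symm hl hj hi k
end
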